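/- Let G be a connected unicyclic graph with m edges whose unique cycle C = v₁v₂v₃v₄v₅v₆v₁ has length 6 (girth 6). If there is NO index i (mod 6) with l(vᵢ) ≤ 1, l(v_{i+3}) ≤ 1 and l(v_{i+1}) = l(v_{i+2}) = l(v_{i+4}) = l(v_{i+5}) = 0, then rc(G) ≤ m − 4. -/

import Mathlib

/-- An edge-colored graph is rainbow connected if every two vertices are
joined by a path no two of whose edges have the same color. -/
def IsRainbowConnected {V α : Type*} (G : SimpleGraph V) (c : Sym2 V → α) : Prop :=
  ∀ u w : V, ∃ p : G.Walk u w, p.IsPath ∧ (p.edges.map c).Nodup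

/-- The rainbow connection number: the minimum number of colors in an
edge-coloring making the graph rainbow connected. -/
noncomputable def rc {V : Type*} (G : SimpleGraph V) : ℕ :=
  sInf {k : ℕ | ∃ c : Sym2 V → Fin k, IsRainbowConnected G c}

/-- The set of edges of the cycle `v 0 — v 1 — ⋯ — v (s-1) — v 0`. -/
def cycleEdges {V : Type*} {s : ℕ} (v : ZMod s → V) : Set (Sym2 V) :=
  {e | ∃ i : ZMod s, e = s(v i, v (i + 1))}

/-- `numLeaves G v i` is `l(vᵢ)`: the number of leaves of the tree `T(vᵢ)`
attached at the cycle vertex `vᵢ`, i.e. the number of vertices, other than the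
root `vᵢ`, of degree 1 in the component of `G − E(C)` containing `vᵢ`. -/
noncomputable def numLeaves {V : Type*} [Fintype V] (G : SimpleGraph V) {s : ℕ}
    (v : ZMod s → V) (i : ZMod s) : ℕ :=
  {x : V | x ≠ v i ∧ (G.deleteEdges (cycleEdges v)).Reachable (v i) x ∧
    ((G.deleteEdges (cycleEdges v)).neighborSet x).ncard = 1}.ncard

open SimpleGraph

/-- The list of values taken by `κ` on `n` consecutive elements of `ZMod 6`, starting at `i`. -/
def arcColors {β : Type*} (κ : ZMod 6 → β) (i : ZMod 6) (n : ℕ) : List β :=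
  (List.range n).map fun k => κ (i + k)

/-- The arc from `i` to `j` is rainbow and avoids the leaf colors in `s` and `t`. -/
def ArcGood (κ : ZMod 6 → Bool ⊕ Fin 2) (s t : Option (Fin 2)) (i j : ZMod 6) : Prop :=
  (arcColors κ i (j - i).val).Nodup ∧
    ∀ c ∈ arcColors κ i (j - i).val, ∀ k, s = some k ∨ t = some k → c ≠ Sum.inr k

instance (κ : ZMod 6 → Bool ⊕ Fin 2) (s t : Option (Fin 2)) (i j : ZMod 6) :
    Decidable (ArcGood κ s t i j) := by unfold ArcGood; infer_instance

/-- With leaf `k` hanging at position `p k` of the hexagon and its pendant edge colored `inr k`,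
any two distinct positions, each possibly extended by a leaf hanging there, are joined by a
rainbow arc avoiding the colors of these leaves. -/
def GoodPattern (κ : ZMod 6 → Bool ⊕ Fin 2) (p : Fin 2 → ZMod 6) : Prop :=
  ∀ i j : ZMod 6, i ≠ j → ∀ s t : Option (Fin 2), (∀ k, s = some k → p k = i) →
    (∀ k, t = some k → p k = j) → ArcGood κ s t i j ∨ ArcGood κ s t j i

instance (κ : ZMod 6 → Bool ⊕ Fin 2) (p : Fin 2 → ZMod 6) :
    Decidable (GoodPattern κ p) := by
  unfold GoodPattern; infer_instance

/-- The sequence `a` of six colors, placed on the hexagon from position `q` on. -/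
def cyclicPattern (a : Fin 6 → Bool ⊕ Fin 2) (q k : ZMod 6) : Bool ⊕ Fin 2 := a (k - q)

lemma arcColors_cyclicPattern (a : Fin 6 → Bool ⊕ Fin 2) (q i : ZMod 6) (n : ℕ) :
    arcColors (cyclicPattern a q) i n = arcColors (cyclicPattern a 0) (i - q) n := by
  simp [arcColors, cyclicPattern, sub_add_eq_add_sub]

lemma GoodPattern.rotate {a : Fin 6 → Bool ⊕ Fin 2} {p : Fin 2 → ZMod 6}
    (h : GoodPattern (cyclicPattern a 0) p) (q : ZMod 6) :
    GoodPattern (cyclicPattern a q) (fun k => q + p k) := by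
  intro i j hij s t hs ht
  have := h (i - q) (j - q) (by simpa using hij) s t
    (fun k hk => by rw [← hs k hk]; ring) (fun k hk => by rw [← ht k hk]; ring)
  simpa only [ArcGood, arcColors_cyclicPattern a q, sub_sub_sub_cancel_right] using this

open Sum in
lemma goodPattern_zero_zero : GoodPattern
    (cyclicPattern ![inl false, inl true, inr 0, inr 1, inl false, inl true] 0)
    ![0, 0] := by
  decide +kernel

open Sum in
lemma goodPattern_zero_one : GoodPattern
    (cyclicPattern ![inl false, inl true, inr 0, inl false, inr 1, inl true] 0)
    ![0, 1] := by
  decide +kernel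

open Sum in
lemma goodPattern_zero_two : GoodPattern
    (cyclicPattern ![inl false, inl true, inr 0, inl false, inl true, inr 1] 0)
    ![0, 2] := by
  decide +kernel

lemma exists_large_or_close_pair (l : ZMod 6 → ℕ)
    (hl : ¬ ∃ i : ZMod 6, l i ≤ 1 ∧ l (i + 3) ≤ 1 ∧
      l (i + 1) = 0 ∧ l (i + 2) = 0 ∧ l (i + 4) = 0 ∧ l (i + 5) = 0) :
    (∃ i, 2 ≤ l i) ∨ (∃ i, 1 ≤ l i ∧ 1 ≤ l (i + 1)) ∨ ∃ i, 1 ≤ l i ∧ 1 ≤ l (i + 2) := by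
  by_contra! h
  obtain ⟨h1, h2, h3⟩ := h
  push Not at hl
  by_cases hz : ∃ i, l i ≠ 0
  · obtain ⟨i, hi⟩ := hz
    have e4 : i + 4 + 2 = i := by rw [add_assoc, show (4 + 2 : ZMod 6) = 0 from rfl, add_zero]
    have e5 : i + 5 + 1 = i := by rw [add_assoc, show (5 + 1 : ZMod 6) = 0 from rfl, add_zero]
    have a4 := h3 (i + 4)
    have a5 := h2 (i + 5)
    rw [e4] at a4
    rw [e5] at a5
    have := hl i
    have := h1 i
    have := h1 (i + 3)
    have := h2 i
    have := h3 i
    omega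
  · push Not at hz
    simpa [hz] using hl 0

lemma eq_of_eq_of_cyclic_steps {α : Type*} (f : ZMod 6 → α) (i j : ZMod 6) (hij : i ≠ j)
    (h : f i = f j) (hf : ∀ k, k ≠ i → k ≠ j → f k = f (k + 1)) (k : ZMod 6) : f k = f i := by
  revert i j k
  have key : ∀ g : Fin 6 → α, ∀ i j : Fin 6, i ≠ j → g i = g j →
      (∀ k, k ≠ i → k ≠ j → g k = g (k + 1)) → ∀ k, g k = g i := by
    intro g i j hij h hf
    simp only [Fin.forall_fin_succ] at hf ⊢
    fin_cases i <;> fin_cases j <;> simp_all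
  exact key f

section

variable {V : Type*} {G : SimpleGraph V} {v : ZMod 6 → V}

lemma cycleEdges_eq_range (v : ZMod 6 → V) :
    cycleEdges v = Set.range fun i => s(v i, v (i + 1)) := by
  ext e; simp [cycleEdges, eq_comm]

lemma cycleEdge_injective (hinj : Function.Injective v) :
    Function.Injective fun i => s(v i, v (i + 1)) := by
  intro i j h
  simp only [Sym2.eq_iff, hinj.eq_iff] at h
  revert i j
  decide

lemma exists_reachable_root (hconn : G.Connected) (v : ZMod 6 → V) (x : V) :
    ∃ i, (G.deleteEdges (cycleEdges v)).Reachable (v i) x := by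
  obtain ⟨p⟩ := hconn.preconnected (v 0) x
  suffices ∀ {a b : V} (_ : G.Walk a b), (∃ i, (G.deleteEdges (cycleEdges v)).Reachable (v i) a) →
      ∃ i, (G.deleteEdges (cycleEdges v)).Reachable (v i) b from this p ⟨0, .rfl⟩
  intro a b p
  induction p with
  | nil => exact id
  | @cons a b c hab _ ih =>
    rintro ⟨i, hi⟩
    apply ih
    by_cases hc : s(a, b) ∈ cycleEdges v
    · obtain ⟨j, hj⟩ := hc
      rcases Sym2.eq_iff.1 hj with ⟨-, rfl⟩ | ⟨-, rfl⟩
      exacts [⟨_, .rfl⟩, ⟨_, .rfl⟩]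
    · exact ⟨i, hi.trans (Adj.reachable (by simp [deleteEdges_adj, hab, hc]))⟩

lemma root_unique [Fintype V] (hconn : G.Connected) (huni : G.edgeSet.ncard = Fintype.card V)
    (hinj : Function.Injective v) (hadj : ∀ i, G.Adj (v i) (v (i + 1))) {i j : ZMod 6}
    (h : (G.deleteEdges (cycleEdges v)).Reachable (v i) (v j)) : i = j := by
  by_contra hij
  set D : Set (Sym2 V) := {s(v i, v (i + 1)), s(v j, v (j + 1))} with hD
  set H := G.deleteEdges D with hH
  have hsub : D ⊆ cycleEdges v := by
    rintro e (rfl | rfl)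
    exacts [⟨i, rfl⟩, ⟨j, rfl⟩]
  have hDG : D ⊆ G.edgeSet := by
    rintro e (rfl | rfl)
    exacts [hadj i, hadj j]
  have hle : G.deleteEdges (cycleEdges v) ≤ H := deleteEdges_anti hsub
  have hcyc : ∀ k, H.connectedComponentMk (v k) = H.connectedComponentMk (v i) := by
    refine eq_of_eq_of_cyclic_steps (fun k => H.connectedComponentMk (v k)) i j hij
      (ConnectedComponent.sound (h.mono hle)) fun k hki hkj => ConnectedComponent.sound ?_
    refine Adj.reachable ((deleteEdges_adj).2 ⟨hadj k, ?_⟩)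
    rintro (h | h)
    exacts [hki (cycleEdge_injective hinj h), hkj (cycleEdge_injective hinj h)]
  have hall : ∀ x, H.Reachable (v i) x := fun x => by
    obtain ⟨k, hk⟩ := exists_reachable_root hconn v x
    exact (ConnectedComponent.exact (hcyc k)).symm.trans (hk.mono hle)
  have hHc : H.Connected :=
    { preconnected := fun x y => (hall x).symm.trans (hall y), nonempty := ⟨v i⟩ }
  have h1 := hHc.card_vert_le_card_edgeSet_add_one
  have h2 : H.edgeSet.ncard = G.edgeSet.ncard - D.ncard := by
    rw [hH, edgeSet_deleteEdges]
    exact Set.ncard_sdiff hDG (Set.toFinite _)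
  have h3 : D.ncard = 2 := Set.ncard_pair fun h => hij (cycleEdge_injective hinj h)
  have h4 := Set.ncard_le_ncard hDG (Set.toFinite _)
  rw [Nat.card_coe_set_eq] at h1
  rw [Nat.card_eq_fintype_card] at h1
  omega

/-- A path using the edge at a vertex `x` of degree one starts or ends at `x`. -/
lemma leaf_edge_mem_path {H : SimpleGraph V} {a y x w : V} (hx : H.neighborSet x = {w})
    {p : H.Walk a y} (hp : p.IsPath) (hxa : x ≠ a) (he : s(x, w) ∈ p.edges) : y = x := by
  classical
  by_contra hy
  have hxs := p.fst_mem_support_of_mem_edges he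
  have hn := hp.isTrail.edges_nodup
  rw [← p.take_spec hxs, Walk.edges_append, List.nodup_append'] at hn
  have h1 : ¬ (p.takeUntil x hxs).Nil := fun h => hxa h.eq.symm
  have h2 : ¬ (p.dropUntil x hxs).Nil := fun h => hy h.eq.symm
  have a1 := Walk.mk_penultimate_end_mem_edges h1
  have a2 := Walk.mk_start_snd_mem_edges h2
  have b1 : (p.takeUntil x hxs).penultimate ∈ H.neighborSet x :=
    (Walk.adj_penultimate h1).symm
  have b2 : (p.dropUntil x hxs).snd ∈ H.neighborSet x := Walk.adj_snd h2
  rw [hx] at b1 b2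
  rw [b1, Sym2.eq_swap] at a1
  rw [b2] at a2
  exact hn.2.2 a1 a2

lemma exists_arc_walk (hadj : ∀ i, G.Adj (v i) (v (i + 1))) {β : Type*} (c : Sym2 V → β)
    (κ : ZMod 6 → β) (hc : ∀ i, c s(v i, v (i + 1)) = κ i) (i : ZMod 6) (n : ℕ) :
    ∃ p : G.Walk (v i) (v (i + n)), p.edges.map c = arcColors κ i n := by
  induction n with
  | zero => exact ⟨Walk.nil.copy rfl (by simp), by simp [arcColors]⟩
  | succ n ih =>
    obtain ⟨p, hp⟩ := ih
    refine ⟨(p.concat (hadj _)).copy rfl (by push_cast; rw [add_assoc]), ?_⟩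
    rw [Walk.edges_copy, Walk.edges_concat, List.concat_eq_append, List.map_append, hp]
    simp [arcColors, List.range_succ, hc]

lemma exists_arc_walk_to (hadj : ∀ i, G.Adj (v i) (v (i + 1))) {β : Type*} (c : Sym2 V → β)
    (κ : ZMod 6 → β) (hc : ∀ i, c s(v i, v (i + 1)) = κ i) (i j : ZMod 6) :
    ∃ p : G.Walk (v i) (v j), p.edges.map c = arcColors κ i (j - i).val := by
  obtain ⟨p, hp⟩ := exists_arc_walk hadj c κ hc i (j - i).val
  exact ⟨p.copy rfl (by simp), by simpa using hp⟩

lemma exists_isRainbowConnected (hinj : Function.Injective v)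
    (hadj : ∀ i, G.Adj (v i) (v (i + 1))) {F : SimpleGraph V}
    (hF : F = G.deleteEdges (cycleEdges v)) (r : V → ZMod 6)
    (P : ∀ y, F.Walk (v (r y)) y) (hP : ∀ y, (P y).IsPath)
    (x : Fin 2 → V) (hx : Function.Injective x)
    (e : Fin 2 → F.edgeSet) (he : Function.Injective e)
    (hex : ∀ k y, (e k : Sym2 V) ∈ (P y).edges → y = x k)
    (κ : ZMod 6 → Bool ⊕ Fin 2) (hκ : GoodPattern κ (r ∘ x)) :
    ∃ c : Sym2 V → Bool ⊕ F.edgeSet, IsRainbowConnected G c := by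
  classical
  have hFG : F ≤ G := hF ▸ deleteEdges_le _
  let g : Bool ⊕ Fin 2 → Bool ⊕ F.edgeSet := Sum.map id e
  have hg : Function.Injective g := Function.injective_id.sumMap he
  let c : Sym2 V → Bool ⊕ F.edgeSet := Function.extend (fun i => s(v i, v (i + 1))) (g ∘ κ)
    fun e => if h : e ∈ F.edgeSet then .inr ⟨e, h⟩ else .inl true
  have hc : ∀ i, c s(v i, v (i + 1)) = (g ∘ κ) i :=
    (cycleEdge_injective hinj).extend_apply _ _
  have hcF : ∀ e (h : e ∈ F.edgeSet), c e = .inr ⟨e, h⟩ := by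
    intro e h
    have hne : ¬ ∃ i, s(v i, v (i + 1)) = e := by
      rw [hF, edgeSet_deleteEdges, cycleEdges_eq_range] at h
      exact h.2
    simp only [c, Function.extend_apply' _ _ _ hne, dif_pos h]
  have hnodup : ∀ {a b : V} (p : F.Walk a b), p.IsPath → (p.edges.map c).Nodup := by
    intro a b p hp
    refine List.Nodup.map_on (fun e₁ h₁ e₂ h₂ h => ?_) hp.isTrail.edges_nodup
    rw [hcF _ (p.edges_subset_edgeSet h₁), hcF _ (p.edges_subset_edgeSet h₂)] at h
    simpa using h
  refine ⟨c, fun u w => ?_⟩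
  by_cases huw : F.Reachable u w
  · obtain ⟨p, hp⟩ := huw.exists_isPath
    exact ⟨p.mapLe hFG, hp.mapLe hFG, by simpa using hnodup p hp⟩
  have hr : r u ≠ r w := fun h => huw ((P u).reachable.symm.trans (h ▸ (P w).reachable))
  have hs : ∀ y, ∃ s : Option (Fin 2), ∀ k, s = some k ↔ x k = y := by
    intro y
    by_cases h : ∃ k, x k = y
    · obtain ⟨k, rfl⟩ := h
      exact ⟨some k, fun l => by simp [hx.eq_iff, eq_comm]⟩
    · exact ⟨none, fun l => by simpa using fun hl => h ⟨l, hl⟩⟩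
  obtain ⟨s, hs'⟩ := hs u
  obtain ⟨t, ht'⟩ := hs w
  have harc : ∃ p : G.Walk (v (r u)) (v (r w)), ∃ l : List (Bool ⊕ Fin 2),
      (p.edges.map c).Perm (l.map g) ∧ l.Nodup ∧
        ∀ a ∈ l, ∀ k, s = some k ∨ t = some k → a ≠ Sum.inr k := by
    have hmap : ∀ i n, arcColors (g ∘ κ) i n = (arcColors κ i n).map g := by simp [arcColors]
    rcases hκ (r u) (r w) hr s t (fun k hk => by simp [(hs' k).1 hk])
      (fun k hk => by simp [(ht' k).1 hk]) with h | h
    · obtain ⟨p, hp⟩ := exists_arc_walk_to hadj c _ hc (r u) (r w)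
      exact ⟨p, _, by rw [hp, hmap], h⟩
    · obtain ⟨p, hp⟩ := exists_arc_walk_to hadj c _ hc (r w) (r u)
      refine ⟨p.reverse, _, ?_, h⟩
      rw [Walk.edges_reverse, List.map_reverse, hp, hmap]
      exact List.reverse_perm _
  obtain ⟨p, l, hpl, hl, hlst⟩ := harc
  have hdisj : ∀ y, (y = u ∨ y = w) → ((P y).edges.map c).Disjoint (p.edges.map c) := by
    intro y hy a ha hap
    obtain ⟨f, hf, rfl⟩ := List.mem_map.1 ha
    obtain ⟨b, hb, hbf⟩ := List.mem_map.1 (hpl.subset hap)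
    rw [hcF _ ((P y).edges_subset_edgeSet hf)] at hbf
    rcases b with b | k
    · simp [g] at hbf
    · have hk : (e k : Sym2 V) = f := by simpa [g, Subtype.ext_iff] using hbf
      have hyk := hex k y (hk ▸ hf)
      refine hlst _ hb k ?_ rfl
      rw [hs', ht']
      rcases hy with rfl | rfl <;> simp [hyk]
  have hPP : ((P u).edges.map c).Disjoint ((P w).edges.map c) := by
    intro a hu hw
    obtain ⟨f, hf, rfl⟩ := List.mem_map.1 hu
    obtain ⟨f', hf', h⟩ := List.mem_map.1 hw
    rw [hcF _ ((P u).edges_subset_edgeSet hf), hcF _ ((P w).edges_subset_edgeSet hf')] at h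
    obtain rfl : f' = f := by simpa using h
    induction f' with | _ a b =>
    exact huw (((P u).dropUntil _ ((P u).fst_mem_support_of_mem_edges hf)).reachable.symm.trans
      ((P w).dropUntil _ ((P w).fst_mem_support_of_mem_edges hf')).reachable)
  let q : G.Walk u w := (((P u).mapLe hFG).reverse.append p).append ((P w).mapLe hFG)
  have hq : (q.edges.map c).Nodup := by
    have hp : (p.edges.map c).Nodup := hpl.nodup_iff.2 (hl.map hg)
    simp only [q, Walk.edges_append, Walk.edges_reverse, Walk.edges_mapLe_eq_edges,
      List.map_append, List.map_reverse, List.nodup_append', List.nodup_reverse,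
      List.disjoint_append_left, List.disjoint_reverse_left]
    exact ⟨⟨hnodup _ (hP u), hp, hdisj u (.inl rfl)⟩, hnodup _ (hP w), hPP,
      (hdisj w (.inr rfl)).symm⟩
  exact ⟨q.bypass, q.bypass_isPath, hq.sublist (q.edges_bypass_sublist_edges.map c)⟩

lemma rc_le_card {β : Type*} [Fintype β] {c : Sym2 V → β} (h : IsRainbowConnected G c) :
    rc G ≤ Fintype.card β := by
  refine Nat.sInf_le ⟨Fintype.equivFin β ∘ c, fun u w => ?_⟩
  obtain ⟨p, hp, hn⟩ := h u w
  exact ⟨p, hp, by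
    rw [← List.map_map]
    exact hn.map (Fintype.equivFin β).injective⟩

end

/-- Let `G` be a connected unicyclic graph with m edges whose unique
cycle `v₁v₂v₃v₄v₅v₆v₁` has length 6. If there is no index `i` (mod 6) with
`l(vᵢ) ≤ 1`, `l(v_{i+3}) ≤ 1` and `l(v_{i+1}) = l(v_{i+2}) = l(v_{i+4}) = l(v_{i+5}) = 0`,
then rc(G) ≤ m − 4. -/
theorem stmt_16 {V : Type*} [Fintype V] (G : SimpleGraph V)
    (hconn : G.Connected) (huni : G.edgeSet.ncard = Fintype.card V)
    (v : ZMod 6 → V) (hinj : Function.Injective v)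
    (hadj : ∀ i : ZMod 6, G.Adj (v i) (v (i + 1)))
    (hl : ¬ ∃ i : ZMod 6, numLeaves G v i ≤ 1 ∧ numLeaves G v (i + 3) ≤ 1 ∧
      numLeaves G v (i + 1) = 0 ∧ numLeaves G v (i + 2) = 0 ∧
      numLeaves G v (i + 4) = 0 ∧ numLeaves G v (i + 5) = 0) :
    rc G ≤ G.edgeSet.ncard - 4 := by
  classical
  set F := G.deleteEdges (cycleEdges v) with hF
  have hroot := exists_reachable_root hconn v
  choose r hr using hroot
  have hru : ∀ {i y}, F.Reachable (v i) y → r y = i := fun h =>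
    root_unique hconn huni hinj hadj ((hr _).trans h.symm)
  choose P hP using fun y => (hr y).exists_isPath
  -- two leaves whose roots carry a good pattern suffice
  have main : ∀ (x : Fin 2 → V) (p : Fin 2 → ZMod 6) (κ : ZMod 6 → Bool ⊕ Fin 2),
      Function.Injective x → GoodPattern κ p →
      (∀ k, x k ≠ v (p k) ∧ F.Reachable (v (p k)) (x k) ∧ (F.neighborSet (x k)).ncard = 1) →
      rc G ≤ G.edgeSet.ncard - 4 := by
    intro x p κ hx hκ hleaf
    have hrx : r ∘ x = p := funext fun k => hru (hleaf k).2.1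
    choose w hw using fun k => Set.ncard_eq_one.1 (hleaf k).2.2
    have hxv : ∀ k i, x k ≠ v i := by
      intro k i h
      have h1 : r (x k) = i := hru (h ▸ .rfl)
      have h2 := hru (hleaf k).2.1
      exact (hleaf k).1 (by rw [← h2, h1, h])
    have hadjw : ∀ k, F.Adj (x k) (w k) := fun k => by
      have : w k ∈ F.neighborSet (x k) := by rw [hw]; rfl
      exact this
    have hex : ∀ k y, s(x k, w k) ∈ (P y).edges → y = x k := fun k y h =>
      leaf_edge_mem_path (hw k) (hP y) (hxv k _) h
    have hmem : ∀ k, s(x k, w k) ∈ (P (x k)).edges := fun k => by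
      have hn : ¬ (P (x k)).Nil := fun h => hxv k _ h.eq.symm
      have h1 : (P (x k)).penultimate ∈ F.neighborSet (x k) := (Walk.adj_penultimate hn).symm
      rw [hw] at h1
      rw [← Set.mem_singleton_iff.1 h1, Sym2.eq_swap]
      exact Walk.mk_penultimate_end_mem_edges hn
    obtain ⟨c, hc⟩ := exists_isRainbowConnected hinj hadj hF r P hP x hx
      (fun k => ⟨s(x k, w k), hadjw k⟩)
      (fun k l hkl => by
        have h : s(x k, w k) = s(x l, w l) := congrArg Subtype.val hkl
        exact hx (hex l _ (h ▸ hmem k))) hex κ (hrx ▸ hκ)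
    refine (rc_le_card hc).trans_eq ?_
    have h6 : (cycleEdges v).ncard = 6 := by
      rw [cycleEdges_eq_range, Set.ncard_range_of_injective (cycleEdge_injective hinj)]
      simp
    have hsub : cycleEdges v ⊆ G.edgeSet := by
      rintro e ⟨i, rfl⟩
      exact hadj i
    have h1 : F.edgeSet.ncard = G.edgeSet.ncard - 6 := by
      rw [hF, edgeSet_deleteEdges, Set.ncard_sdiff hsub (Set.toFinite _), h6]
    have h2 := Set.ncard_le_ncard hsub (Set.toFinite _)
    rw [Fintype.card_sum, Fintype.card_bool, ← Nat.card_eq_fintype_card, Nat.card_coe_set_eq]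
    change 2 + F.edgeSet.ncard = _
    omega
  have main₂ : ∀ i j κ, i ≠ j → 1 ≤ numLeaves G v i → 1 ≤ numLeaves G v j →
      GoodPattern κ ![i, j] → rc G ≤ G.edgeSet.ncard - 4 := by
    intro i j κ hij hi hj hκ
    obtain ⟨x, hx⟩ := Set.nonempty_of_ncard_ne_zero (Nat.one_le_iff_ne_zero.1 hi)
    obtain ⟨y, hy⟩ := Set.nonempty_of_ncard_ne_zero (Nat.one_le_iff_ne_zero.1 hj)
    refine main ![x, y] ![i, j] κ ?_ hκ (Fin.forall_fin_two.2 ⟨hx, hy⟩)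
    rw [Function.Injective, Fin.forall_fin_two]
    have hxy : x ≠ y := by
      rintro rfl
      exact hij ((hru hx.2.1).symm.trans (hru hy.2.1))
    simp [Fin.forall_fin_two, hxy, hxy.symm]
  rcases exists_large_or_close_pair (numLeaves G v) hl with ⟨i, hi⟩ | ⟨i, h1, h2⟩ | ⟨i, h1, h2⟩
  · obtain ⟨x, y, hx, hy, hxy⟩ := (Set.one_lt_ncard_iff (Set.toFinite _)).1 hi
    refine main ![x, y] _ _ ?_ (goodPattern_zero_zero.rotate i)
      (Fin.forall_fin_two.2 ⟨by simpa using hx, by simpa using hy⟩)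
    rw [Function.Injective, Fin.forall_fin_two]
    simp [Fin.forall_fin_two, hxy, hxy.symm]
  · have hκ := goodPattern_zero_one.rotate i
    rw [show (fun k => i + ![0, 1] k) = ![i, i + 1] by ext k; fin_cases k <;> simp] at hκ
    exact main₂ i (i + 1) _ (by simp; decide) h1 h2 hκ
  · have hκ := goodPattern_zero_two.rotate i
    rw [show (fun k => i + ![0, 2] k) = ![i, i + 2] by ext k; fin_cases k <;> simp] at hκ
    exact main₂ i (i + 2) _ (by simp; decide) h1 h2 hκ
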